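/- arXiv:2504.14213 — 9 statements merged into one kernel-verified Lean document; each statement's English description precedes it below -/
import Mathlib

section
/- Let (X,d) be a metric space with |X| ≥ n ≥ 2, let T : X → X be continuous and satisfy: there exists λ ∈ [0,(n−1)/n) with S(Tx₁,…,Txₙ) ≤ λ·Σᵢ₌₁ⁿ d(xᵢ,Txᵢ) for all pairwise distinct x₁,…,xₙ ∈ X. If z ∈ X is an accumulation point of X, then for every y ∈ X the inequality (n−1)·d(Tz,Ty) ≤ λ((n−1)·d(z,Tz) + d(y,Ty)) holds. -/
open Finset Filter Topology

/-- The sum of all pairwise distances between the points `x 0, …, x (n-1)`. -/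
noncomputable def pairSum {X : Type*} [MetricSpace X] {n : ℕ} (x : Fin n → X) : ℝ :=
  ∑ i : Fin n, ∑ j ∈ Finset.Ioi i, dist (x i) (x j)

theorem continuous_pairSum {X : Type*} [MetricSpace X] {n : ℕ} :
    Continuous (pairSum : (Fin n → X) → ℝ) := by
  unfold pairSum
  fun_prop

theorem pairSum_cons_const {X : Type*} [MetricSpace X] {k : ℕ} (y z : X) :
    pairSum (Fin.cons y (fun _ => z) : Fin (k + 1) → X) = k * dist y z := by
  simp [pairSum, Fin.sum_univ_succ, Fin.sum_Ioi_succ]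

/-- If `T` is a continuous `n`-point Kannan-type mapping and `z` is an accumulation
point of `X` (limit of a pairwise distinct sequence of points all different from `z`),
then `(n−1)·d(Tz,Ty) ≤ λ((n−1)·d(z,Tz) + d(y,Ty))` for every `y`. -/
theorem statement1 {X : Type*} [MetricSpace X] (n : ℕ) (hn : 2 ≤ n)
    (hcard : ∃ f : Fin n → X, Function.Injective f)
    (T : X → X) (hTc : Continuous T)
    (lam : ℝ) (hlam0 : 0 ≤ lam) (hlam1 : lam < ((n : ℝ) - 1) / n)
    (hK : ∀ x : Fin n → X, Function.Injective x →
      pairSum (fun i => T (x i)) ≤ lam * ∑ i : Fin n, dist (x i) (T (x i)))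
    (z : X)
    (hz : ∃ u : ℕ → X, Function.Injective u ∧ (∀ m, u m ≠ z) ∧
      Filter.Tendsto u Filter.atTop (nhds z)) :
    ∀ y : X, ((n : ℝ) - 1) * dist (T z) (T y) ≤
      lam * (((n : ℝ) - 1) * dist z (T z) + dist y (T y)) := by
  intro y
  obtain ⟨u, hu, -, hlim⟩ := hz
  obtain ⟨k, rfl⟩ : ∃ k, n = k + 1 := ⟨n - 1, by lia⟩
  let x : ℕ → Fin (k + 1) → X := fun m => Fin.cons y (fun i : Fin k => u (m + i))
  let w : Fin (k + 1) → X := Fin.cons y (fun _ => z)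
  have hx : Tendsto x atTop (𝓝 w) := by
    refine tendsto_pi_nhds.2 (Fin.cases ?_ fun i => ?_)
    · exact tendsto_const_nhds
    · exact hlim.comp (tendsto_add_atTop_nat (i : ℕ))
  obtain ⟨N, hN⟩ : ∃ N, ∀ m ≥ N, u m ≠ y := by
    by_cases h : ∃ m, u m = y
    · obtain ⟨p, rfl⟩ := h
      exact ⟨p + 1, fun m hm h => by have := hu h; lia⟩
    · exact ⟨0, fun m _ hm => h ⟨m, hm⟩⟩
  have hinj : ∀ m ≥ N, Function.Injective (x m) := fun m hm => by
    refine Fin.cons_injective_iff.2 ⟨?_, fun i j hij => ?_⟩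
    · rintro ⟨i, hi⟩
      exact hN (m + i) (by lia) hi
    · exact Fin.ext (Nat.add_left_cancel (hu hij))
  have hL : Continuous fun v : Fin (k + 1) → X => pairSum fun i => T (v i) :=
    continuous_pairSum.comp (by fun_prop)
  have hR : Continuous fun v : Fin (k + 1) → X => lam * ∑ i, dist (v i) (T (v i)) := by
    fun_prop
  have key := le_of_tendsto_of_tendsto ((hL.tendsto w).comp hx) ((hR.tendsto w).comp hx)
    (eventually_atTop.2 ⟨N, fun m hm => hK _ (hinj m hm)⟩)
  have hTw : (fun i => T (w i)) = Fin.cons (T y) (fun _ => T z) :=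
    funext (Fin.cases rfl fun _ => rfl)
  rw [hTw, pairSum_cons_const, Fin.sum_univ_succ] at key
  simp only [w, Fin.cons_zero, Fin.cons_succ, sum_const, card_univ, Fintype.card_fin,
    nsmul_eq_mul] at key
  push_cast
  rw [dist_comm (T z), add_sub_cancel_right, add_comm (_ * _)]
  exact key
end

section
/- Let (X,d) be a metric space with |X| ≥ n ≥ 2, and let T : X → X satisfy S(Tx₁,…,Txₙ) ≤ α·S(x₁,…,xₙ) for all pairwise distinct x₁,…,xₙ ∈ X, with 0 ≤ α < 1/(n+1). Then T is an n-point Kannan-type mapping; more precisely, S(Tx₁,…,Txₙ) ≤ (α(n−1)/(1−α))·Σᵢ₌₁ⁿ d(xᵢ,Txᵢ) for all pairwise distinct x₁,…,xₙ ∈ X, and α(n−1)/(1−α) ∈ [0,(n−1)/n). -/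
open Finset Filter Topology

/-- Summing `a i + a j` over all pairs `i < j` counts every `a i` exactly `n - 1` times. -/
theorem sum_pairs_add {n : ℕ} (a : Fin n → ℝ) :
    ∑ i : Fin n, ∑ j ∈ Finset.Ioi i, (a i + a j) = ((n : ℝ) - 1) * ∑ i : Fin n, a i := by
  have hswap : ∑ i : Fin n, ∑ j ∈ Finset.Ioi i, a j = ∑ j : Fin n, ∑ _i ∈ Finset.Iio j, a j :=
    Finset.sum_comm' (by simp)
  simp only [Finset.sum_add_distrib]
  rw [hswap, ← Finset.sum_add_distrib, Finset.mul_sum]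
  refine Finset.sum_congr rfl fun i _ => ?_
  have hcount : ((n - 1 - (i : ℕ) : ℕ) : ℝ) + ((i : ℕ) : ℝ) = (n : ℝ) - 1 := by
    have hi := i.isLt
    rw [← Nat.cast_add, show n - 1 - (i : ℕ) + i = n - 1 by omega, Nat.cast_sub (by omega),
      Nat.cast_one]
  rw [Finset.sum_const, Finset.sum_const, Fin.card_Ioi, Fin.card_Iio, nsmul_eq_mul,
    nsmul_eq_mul, ← add_mul, hcount]

/-- Moving every point of a configuration changes the total pairwise distance by at most
`n - 1` times the total displacement. -/
theorem pairSum_le_add {X : Type*} [MetricSpace X] {n : ℕ} (x y : Fin n → X) :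
    pairSum x ≤ ((n : ℝ) - 1) * ∑ i : Fin n, dist (x i) (y i) + pairSum y := by
  rw [← sum_pairs_add, pairSum, pairSum, ← Finset.sum_add_distrib]
  refine Finset.sum_le_sum fun i _ => ?_
  rw [← Finset.sum_add_distrib]
  refine Finset.sum_le_sum fun j _ => ?_
  have h := dist_triangle4 (x i) (y i) (y j) (x j)
  rw [dist_comm (y j)] at h
  linarith

/-- Every mapping contracting the total pairwise distances between `n` points with
`α ∈ [0, 1/(n+1))` is an `n`-point Kannan-type mapping with constant
`α(n−1)/(1−α) ∈ [0, (n−1)/n)`. -/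
theorem statement3 {X : Type*} [MetricSpace X] (n : ℕ) (hn : 2 ≤ n)
    (hcard : ∃ f : Fin n → X, Function.Injective f)
    (T : X → X) (α : ℝ) (hα0 : 0 ≤ α) (hα1 : α < 1 / ((n : ℝ) + 1))
    (hC : ∀ x : Fin n → X, Function.Injective x →
      pairSum (fun i => T (x i)) ≤ α * pairSum x) :
    (∀ x : Fin n → X, Function.Injective x →
      pairSum (fun i => T (x i)) ≤
        α * ((n : ℝ) - 1) / (1 - α) * ∑ i : Fin n, dist (x i) (T (x i))) ∧
    0 ≤ α * ((n : ℝ) - 1) / (1 - α) ∧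
    α * ((n : ℝ) - 1) / (1 - α) < ((n : ℝ) - 1) / n := by
  have hn' : (2 : ℝ) ≤ n := by exact_mod_cast hn
  have hα : α * ((n : ℝ) + 1) < 1 := (lt_div_iff₀ (by linarith)).mp hα1
  have hpos : 0 < 1 - α := by nlinarith
  refine ⟨fun x hx => ?_, ?_, ?_⟩
  · rw [div_mul_eq_mul_div, le_div_iff₀ hpos]
    have h := mul_le_mul_of_nonneg_left (pairSum_le_add x fun i => T (x i)) hα0
    linarith [hC x hx]
  · exact div_nonneg (mul_nonneg hα0 (by linarith)) hpos.le
  · rw [div_lt_div_iff₀ hpos (by linarith)]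
    nlinarith
end

section
/- Let (X,d) be a metric space, n ≥ 2 a natural number, and (x_m)_{m≥0} a sequence in X. Set p_m = d(x_m, x_{m+1}). Suppose there exists ρ ∈ [0,1) such that for every m ≥ n−1 the inequality p_m ≤ ρ·max_{m−n+1 ≤ i ≤ m−1} p_i holds. Then (x_m) is a Cauchy sequence. -/
open Finset Filter Topology

theorem exists_pos_lt_one_le_pow {ρ : ℝ} (hρ0 : 0 ≤ ρ) (hρ1 : ρ < 1) {k : ℕ} (hk : 1 ≤ k) :
    ∃ r : ℝ, 0 < r ∧ r < 1 ∧ ρ ≤ r ^ k := by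
  have hk' : (1 : ℝ) ≤ k := by exact_mod_cast hk
  have hδ0 : 0 < (1 - ρ) / (2 * k) := div_pos (by linarith) (by linarith)
  have hδ1 : (1 - ρ) / (2 * k) ≤ 1 / 2 := by
    rw [div_le_div_iff₀ (by linarith) (by norm_num)]
    linarith
  have hδ : (k : ℝ) * ((1 - ρ) / (2 * k)) = (1 - ρ) / 2 := by
    field_simp
  refine ⟨1 + -((1 - ρ) / (2 * k)), by linarith, by linarith, ?_⟩
  have hpow := one_add_mul_le_pow (a := -((1 - ρ) / (2 * k))) (by linarith) k
  linarith

/-- A nonnegative sequence each of whose terms is at most `r ^ k` times one of the `k` previous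
terms decays geometrically with ratio `r`. -/
theorem exists_le_mul_pow_of_le_pow_mul {p : ℕ → ℝ} (hp : ∀ m, 0 ≤ p m) {k : ℕ} {r : ℝ}
    (hr0 : 0 < r) (hr1 : r ≤ 1)
    (h : ∀ m, k ≤ m → ∃ i, m - k ≤ i ∧ i < m ∧ p m ≤ r ^ k * p i) :
    ∃ C, ∀ m, p m ≤ C * r ^ m := by
  have hS : 0 ≤ ∑ i ∈ range k, p i := sum_nonneg fun i _ => hp i
  have hC : 0 ≤ (∑ i ∈ range k, p i) / r ^ k := by positivity
  refine ⟨(∑ i ∈ range k, p i) / r ^ k, fun m => ?_⟩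
  induction m using Nat.strong_induction_on with
  | _ m ih =>
    rcases lt_or_ge m k with hmk | hkm
    · calc p m ≤ ∑ i ∈ range k, p i :=
            single_le_sum (fun i _ => hp i) (mem_range.mpr hmk)
        _ = (∑ i ∈ range k, p i) / r ^ k * r ^ k := by field_simp
        _ ≤ (∑ i ∈ range k, p i) / r ^ k * r ^ m :=
            mul_le_mul_of_nonneg_left (pow_le_pow_of_le_one hr0.le hr1 hmk.le) hC
    · obtain ⟨i, hi, him, hpi⟩ := h m hkm
      calc p m ≤ r ^ k * p i := hpi
        _ ≤ r ^ k * ((∑ i ∈ range k, p i) / r ^ k * r ^ i) :=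
            mul_le_mul_of_nonneg_left (ih i him) (by positivity)
        _ = (∑ i ∈ range k, p i) / r ^ k * r ^ (k + i) := by ring
        _ ≤ (∑ i ∈ range k, p i) / r ^ k * r ^ m :=
            mul_le_mul_of_nonneg_left (pow_le_pow_of_le_one hr0.le hr1 (by omega)) hC

/-- If every distance `p_m = d(x_m, x_{m+1})` with `m ≥ n−1` is at most `ρ` times the
maximum of the `n−1` previous distances, for some `ρ ∈ [0,1)`, then `(x_m)` is a
Cauchy sequence. -/
theorem statement4 {X : Type*} [MetricSpace X] (n : ℕ) (hn : 2 ≤ n)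
    (x : ℕ → X) (ρ : ℝ) (hρ0 : 0 ≤ ρ) (hρ1 : ρ < 1)
    (h : ∀ m, ∀ hm : n - 1 ≤ m,
      dist (x m) (x (m + 1)) ≤
        ρ * (Finset.Icc (m - (n - 1)) (m - 1)).sup'
          (Finset.nonempty_Icc.mpr (by omega))
          (fun i => dist (x i) (x (i + 1)))) :
    CauchySeq x := by
  obtain ⟨r, hr0, hr1, hr⟩ := exists_pos_lt_one_le_pow hρ0 hρ1 (k := n - 1) (by omega)
  obtain ⟨C, hC⟩ := exists_le_mul_pow_of_le_pow_mul (p := fun m => dist (x m) (x (m + 1)))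
    (fun _ => dist_nonneg) hr0 hr1.le (k := n - 1) (fun m hm => by
      obtain ⟨i, hi, hmax⟩ := exists_mem_eq_sup' (s := Icc (m - (n - 1)) (m - 1))
        (nonempty_Icc.mpr (by omega)) (fun i => dist (x i) (x (i + 1)))
      rw [mem_Icc] at hi
      refine ⟨i, hi.1, by omega, (h m hm).trans ?_⟩
      rw [hmax]
      exact mul_le_mul_of_nonneg_right hr dist_nonneg)
  exact cauchySeq_of_le_geometric r C hr1 hC
end

section
/- Let (X,d) be a metric space, n ≥ 2 a natural number, and (x_m)_{m≥0} a sequence in X. Set p_m = d(x_m, x_{m+1}) and P = max{p₀,…,p_{n−2}}. Suppose there exists ρ ∈ [0,1) such that for every m ≥ n−1 the inequality p_m ≤ ρ·max_{m−n+1 ≤ i ≤ m−1} p_i holds. Then for every m ≥ n−1 one has p_m ≤ ρ^{(m−n+2)/(n−1)}·P. -/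
open Finset Filter Topology

/-- If each term of a real sequence from index `k` on is at most `ρ` times one of the preceding
`k` terms, and the first `k` terms are at most `P`, the sequence decays like `ρ ^ (m / k) * P`. -/
theorem le_rpow_mul_of_le_mul_previous {p : ℕ → ℝ} {k : ℕ} (hk : 0 < k) {ρ P : ℝ}
    (hρ0 : 0 ≤ ρ) (hρ1 : ρ ≤ 1) (hP : 0 ≤ P) (hinit : ∀ i < k, p i ≤ P)
    (hstep : ∀ m, k ≤ m → ∃ i < m, m ≤ i + k ∧ p m ≤ ρ * p i) (m : ℕ) (hm : k ≤ m) :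
    p m ≤ ρ ^ (((m : ℝ) - k + 1) / k) * P := by
  have hk' : (0 : ℝ) < k := by exact_mod_cast hk
  induction m using Nat.strong_induction_on with
  | _ m ih =>
    obtain ⟨i, him, hmi, hle⟩ := hstep m hm
    have hm' : (k : ℝ) ≤ m := by exact_mod_cast hm
    have hexp : 0 ≤ ((m : ℝ) - k + 1) / k := div_nonneg (by linarith) hk'.le
    rcases lt_or_ge i k with hik | hki
    · have hmk : (m : ℝ) + 1 ≤ k + k := by
        exact_mod_cast (by omega : m + 1 ≤ k + k)
      have hρ : ρ ≤ ρ ^ (((m : ℝ) - k + 1) / k) := by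
        simpa using Real.rpow_le_rpow_of_exponent_ge' hρ0 hρ1 hexp
          ((div_le_one hk').2 (by linarith))
      calc p m ≤ ρ * p i := hle
        _ ≤ ρ * P := mul_le_mul_of_nonneg_left (hinit i hik) hρ0
        _ ≤ _ := mul_le_mul_of_nonneg_right hρ hP
    · have hki' : (k : ℝ) ≤ i := by exact_mod_cast hki
      have hmi' : (m : ℝ) ≤ i + k := by exact_mod_cast hmi
      have hsum : 1 + ((i : ℝ) - k + 1) / k = (i + 1) / k := by
        field_simp
        ring
      have hρ : ρ * ρ ^ (((i : ℝ) - k + 1) / k) = ρ ^ (((i : ℝ) + 1) / k) := by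
        rw [← hsum, Real.rpow_add_of_nonneg hρ0 zero_le_one
          (div_nonneg (by linarith) hk'.le), Real.rpow_one]
      calc p m ≤ ρ * p i := hle
        _ ≤ ρ * (ρ ^ (((i : ℝ) - k + 1) / k) * P) :=
          mul_le_mul_of_nonneg_left (ih i him hki) hρ0
        _ = ρ ^ (((i : ℝ) + 1) / k) * P := by rw [← mul_assoc, hρ]
        _ ≤ _ := mul_le_mul_of_nonneg_right
          (Real.rpow_le_rpow_of_exponent_ge' hρ0 hρ1 hexp
            (div_le_div_of_nonneg_right (by linarith) hk'.le)) hP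

/-- Under the hypothesis of Lemma 3.1 (each `p_m`, `m ≥ n−1`, is at most `ρ` times the
maximum of the previous `n−1` distances), one has
`p_m ≤ ρ^{(m−n+2)/(n−1)} · P` for all `m ≥ n−1`, where
`P = max{p₀, …, p_{n−2}}`. -/
theorem statement5 {X : Type*} [MetricSpace X] (n : ℕ) (hn : 2 ≤ n)
    (x : ℕ → X) (ρ : ℝ) (hρ0 : 0 ≤ ρ) (hρ1 : ρ < 1)
    (h : ∀ m, ∀ hm : n - 1 ≤ m,
      dist (x m) (x (m + 1)) ≤
        ρ * (Finset.Icc (m - (n - 1)) (m - 1)).sup'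
          (Finset.nonempty_Icc.mpr (by omega))
          (fun i => dist (x i) (x (i + 1)))) :
    ∀ m, n - 1 ≤ m →
      dist (x m) (x (m + 1)) ≤
        ρ ^ (((m : ℝ) - (n : ℝ) + 2) / ((n : ℝ) - 1)) *
          (Finset.range (n - 1)).sup'
            (Finset.nonempty_range_iff.mpr (by omega))
            (fun i => dist (x i) (x (i + 1))) := by
  intro m hm
  have hinit : ∀ i < n - 1, dist (x i) (x (i + 1)) ≤
      (Finset.range (n - 1)).sup' (Finset.nonempty_range_iff.mpr (by omega))
        (fun i => dist (x i) (x (i + 1))) := fun i hi =>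
    Finset.le_sup' (fun i => dist (x i) (x (i + 1))) (Finset.mem_range.2 hi)
  have key := le_rpow_mul_of_le_mul_previous (p := fun i => dist (x i) (x (i + 1)))
    (by omega : 0 < n - 1) hρ0 hρ1.le (dist_nonneg.trans (hinit 0 (by omega))) hinit
    (fun m hm => by
      obtain ⟨i, hi, hsup⟩ := Finset.exists_mem_eq_sup' (s := Finset.Icc (m - (n - 1)) (m - 1))
        (Finset.nonempty_Icc.mpr (by omega)) (fun i => dist (x i) (x (i + 1)))
      have hle := h m hm
      rw [hsup] at hle
      rw [Finset.mem_Icc] at hi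
      exact ⟨i, by omega, by omega, hle⟩) m hm
  have hexp : (m : ℝ) - (n : ℝ) + 2 = (m : ℝ) - ((n : ℝ) - 1) + 1 := by ring
  rw [Nat.cast_sub (by omega : 1 ≤ n), Nat.cast_one] at key
  rw [hexp]
  exact key
end

section
/- Let (X,d) be a complete metric space with |X| ≥ n ≥ 2, and let T : X → X be an n-point Kannan-type mapping. If T has no periodic points of prime period p for any p ∈ {2,3,…,n−1}, then T has a fixed point in X. -/
open Finset Filter Topology

theorem two_mul_pairSum {X : Type*} [MetricSpace X] {n : ℕ} (y : Fin n → X) :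
    2 * pairSum y = ∑ i, ∑ j, dist (y i) (y j) := by
  have h := Finset.sum_sum_Ioi_add_eq_sum_sum_off_diag (fun i j : Fin n => dist (y i) (y j))
  have hdiag (i : Fin n) : ∑ j ∈ ({i}ᶜ : Finset (Fin n)), dist (y j) (y i) =
      ∑ j, dist (y i) (y j) := by
    rw [← Finset.sum_compl_add_sum {i}]
    simp [dist_comm]
  simp only [hdiag] at h
  rw [← h, pairSum, Finset.mul_sum]
  refine Finset.sum_congr rfl fun i _ => ?_
  rw [Finset.mul_sum]
  refine Finset.sum_congr rfl fun j _ => ?_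
  rw [dist_comm (y j), two_mul]

theorem sum_dist_le_pairSum {X : Type*} [MetricSpace X] {n : ℕ} (y : Fin n → X) (i : Fin n) :
    ∑ j, dist (y i) (y j) ≤ pairSum y := by
  have h := two_mul_pairSum y
  rw [← Finset.add_sum_erase _ _ (Finset.mem_univ i)] at h
  have h1 : ∑ a ∈ Finset.univ.erase i, dist (y i) (y a) ≤
      ∑ a ∈ Finset.univ.erase i, ∑ j, dist (y a) (y j) := by
    refine Finset.sum_le_sum fun a _ => ?_
    rw [dist_comm]
    exact Finset.single_le_sum (f := fun j => dist (y a) (y j))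
      (fun _ _ => dist_nonneg) (Finset.mem_univ i)
  have h2 := Finset.add_sum_erase Finset.univ (fun j => dist (y i) (y j)) (Finset.mem_univ i)
  simp only [dist_self, zero_add] at h2
  linarith

theorem mul_dist_le_pairSum {X : Type*} [MetricSpace X] {m : ℕ} (y : Fin (m + 1) → X)
    {i j : Fin (m + 1)} (hij : i ≠ j) : (m : ℝ) * dist (y i) (y j) ≤ pairSum y := by
  have h := two_mul_pairSum y
  have hj : j ∈ Finset.univ.erase i := by simp [hij.symm]
  rw [← Finset.add_sum_erase _ _ (Finset.mem_univ i), ← Finset.add_sum_erase _ _ hj] at h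
  have hrow (a : Fin (m + 1)) : dist (y i) (y j) ≤ ∑ b, dist (y a) (y b) := by
    calc dist (y i) (y j) ≤ dist (y a) (y i) + dist (y a) (y j) := dist_triangle_left _ _ _
      _ = ∑ b ∈ {i, j}, dist (y a) (y b) := by rw [Finset.sum_pair hij]
      _ ≤ _ := Finset.sum_le_sum_of_subset_of_nonneg (Finset.subset_univ _)
        fun _ _ _ => dist_nonneg
  have hrest := Finset.card_nsmul_le_sum ((Finset.univ.erase i).erase j) _ _
    fun a _ => hrow a
  have hcard : (((Finset.univ.erase i).erase j).card : ℝ) = m - 1 := by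
    have h1 := Finset.card_erase_add_one hj
    have h2 := Finset.card_erase_add_one (Finset.mem_univ i)
    rw [Finset.card_univ, Fintype.card_fin] at h2
    have h3 : ((Finset.univ.erase i).erase j).card + 1 = m := by omega
    have h4 : (((Finset.univ.erase i).erase j).card : ℝ) + 1 = m := by exact_mod_cast h3
    linarith
  rw [nsmul_eq_mul, hcard] at hrest
  have hpair : ((m : ℝ) + 1) * dist (y i) (y j) ≤
      ∑ b, dist (y i) (y b) + ∑ b, dist (y j) (y b) := by
    rw [← Finset.sum_add_distrib]
    have := Finset.card_nsmul_le_sum Finset.univ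
      (fun b => dist (y i) (y b) + dist (y j) (y b)) (dist (y i) (y j))
      fun b _ => dist_triangle_right _ _ _
    simpa [nsmul_eq_mul] using this
  linarith

/-- If no point has prime period `1, …, m`, then `m + 1` consecutive iterates are distinct. -/
theorem iterate_injective_fin {X : Type*} {T : X → X} {m : ℕ}
    (hper : ∀ p : ℕ, 1 ≤ p → p ≤ m → ∀ x : X, T^[p] x ≠ x) (z : X) :
    Function.Injective fun i : Fin (m + 1) => T^[i] z := by
  have hlt {i j : Fin (m + 1)} (h : i < j) : T^[i] z ≠ T^[j] z := by
    intro he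
    have h' : (i : ℕ) < j := h
    refine hper (j - i) (by omega) (by omega) (T^[i] z) ?_
    rw [← Function.iterate_add_apply, Nat.sub_add_cancel h'.le, he]
  intro i j he
  rcases lt_trichotomy i j with h | h | h
  · exact absurd he (hlt h)
  · exact h
  · exact absurd he.symm (hlt h)

theorem iterate_ne_self_of_prime_periods {X : Type*} {T : X → X} {m : ℕ}
    (hfix : ∀ x, T x ≠ x)
    (hper : ∀ p : ℕ, 2 ≤ p → p ≤ m →
      ¬∃ x : X, T^[p] x = x ∧ ∀ k : ℕ, 1 ≤ k → k < p → T^[k] x ≠ x)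
    (p : ℕ) (hp : 1 ≤ p) (hpm : p ≤ m) (x : X) : T^[p] x ≠ x := by
  induction p using Nat.strong_induction_on with
  | _ p ih =>
    intro he
    rcases hp.eq_or_lt with rfl | h2
    · exact hfix x he
    · exact hper p h2 hpm ⟨x, he, fun k hk hkp => ih k hkp hk (by omega)⟩

/-- The displacement of a Kannan-type mapping contracts along an orbit. -/
theorem dist_map_le_of_kannan {X : Type*} [MetricSpace X] {m : ℕ} (hm : 1 ≤ m) {T : X → X}
    {lam : ℝ} (hlam0 : 0 ≤ lam) (hlam1 : lam < 1)
    (hK : ∀ x : Fin (m + 1) → X, Function.Injective x →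
      pairSum (fun i => T (x i)) ≤ lam * ∑ i, dist (x i) (T (x i)))
    {z : X} (hz : Function.Injective fun i : Fin (m + 1) => T^[i] z) :
    dist (T z) (T (T z)) ≤ lam / (m * (1 - lam)) * dist z (T z) := by
  have hS := hK _ hz
  have hedge (i : ℕ) (hi : i < m) : (m : ℝ) * dist (T^[i + 1] z) (T (T^[i + 1] z)) ≤
      pairSum fun i : Fin (m + 1) => T (T^[i] z) := by
    have hne : (⟨i, by omega⟩ : Fin (m + 1)) ≠ ⟨i + 1, by omega⟩ := by simp
    simpa [← Function.iterate_succ_apply' T] using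
      mul_dist_le_pairSum (fun i : Fin (m + 1) => T (T^[i] z)) hne
  set P := pairSum fun i : Fin (m + 1) => T (T^[i] z)
  rw [Fin.sum_univ_eq_sum_range (fun i => dist (T^[i] z) (T (T^[i] z))),
    Finset.sum_range_succ'] at hS
  have hm0 : (0 : ℝ) < m := by exact_mod_cast hm
  have hsum : ∑ i ∈ Finset.range m, dist (T^[i + 1] z) (T (T^[i + 1] z)) ≤ P := by
    have h := Finset.sum_le_sum fun i hi => hedge i (Finset.mem_range.1 hi)
    rw [← Finset.mul_sum, Finset.sum_const, Finset.card_range, nsmul_eq_mul] at h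
    exact le_of_mul_le_mul_left h hm0
  have h0 := hedge 0 hm
  simp only [zero_add, Function.iterate_one, Function.iterate_zero, id] at h0 hS
  have hP : P * (1 - lam) ≤ lam * dist z (T z) := by nlinarith
  have hl : 0 < 1 - lam := by linarith
  rw [div_mul_eq_mul_div, le_div_iff₀ (mul_pos hm0 hl)]
  nlinarith

theorem injective_and_tendsto_of_dist_contraction {X : Type*} [MetricSpace X] [CompleteSpace X]
    {q : ℝ} (hq0 : 0 ≤ q) (hq1 : q < 1) {u : ℕ → X}
    (hpos : ∀ k, 0 < dist (u k) (u (k + 1)))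
    (hstep : ∀ k, dist (u (k + 1)) (u (k + 2)) ≤ q * dist (u k) (u (k + 1)))
    (hsucc : ∀ i j, u i = u j → u (i + 1) = u (j + 1)) :
    Function.Injective u ∧ ∃ w, Tendsto u atTop (𝓝 w) := by
  have hanti : StrictAnti fun k => dist (u k) (u (k + 1)) :=
    strictAnti_nat_of_succ_lt fun k =>
      (hstep k).trans_lt (mul_lt_of_lt_one_left (hpos k) hq1)
  refine ⟨fun i j h => hanti.injective (by simp only [hsucc i j h, h]), ?_⟩
  have hgeom (k : ℕ) : dist (u k) (u (k + 1)) ≤ dist (u 0) (u 1) * q ^ k := by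
    induction k with
    | zero => simp
    | succ k ih =>
      calc _ ≤ q * dist (u k) (u (k + 1)) := hstep k
        _ ≤ q * (dist (u 0) (u 1) * q ^ k) := by gcongr
        _ = _ := by ring
  exact cauchySeq_tendsto_of_complete (cauchySeq_of_le_geometric q _ hq1 hgeom)

/-- The limit of an injective orbit of a Kannan-type mapping is a fixed point. -/
theorem map_eq_of_tendsto_of_kannan {X : Type*} [MetricSpace X] {m : ℕ} (hm : 1 ≤ m) {T : X → X}
    {lam : ℝ} (hlam1 : lam < 1)
    (hK : ∀ x : Fin (m + 1) → X, Function.Injective x →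
      pairSum (fun i => T (x i)) ≤ lam * ∑ i, dist (x i) (T (x i)))
    {u : ℕ → X} (hu : ∀ k, u (k + 1) = T (u k)) (huinj : Function.Injective u) {w : X}
    (hw : Tendsto u atTop (𝓝 w)) : T w = w := by
  have hshift (j : ℕ) : Tendsto (fun k => u (k + j)) atTop (𝓝 w) :=
    (tendsto_add_atTop_iff_nat j).2 hw
  have hne : ∀ᶠ k in atTop, ∀ j, w ≠ u (k + j) := by
    by_cases h : ∃ k, u k = w
    · obtain ⟨k₀, rfl⟩ := h
      filter_upwards [eventually_gt_atTop k₀] with k hk j he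
      have := huinj he
      omega
    · exact Eventually.of_forall fun k j he => h ⟨_, he.symm⟩
  have hineq : ∀ᶠ k in atTop, ∑ j : Fin m, dist (T w) (u (k + j + 1)) ≤
      lam * (dist w (T w) + ∑ j : Fin m, dist (u (k + j)) (u (k + j + 1))) := by
    filter_upwards [hne] with k hk
    have hx : Function.Injective (Fin.cons w fun j : Fin m => u (k + j) : Fin (m + 1) → X) := by
      rw [Fin.cons_injective_iff]
      refine ⟨?_, fun i j h => ?_⟩
      · rintro ⟨j, hj⟩
        exact hk j hj.symm
      have := huinj h
      exact Fin.ext (by omega)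
    have h := (sum_dist_le_pairSum _ 0).trans (hK _ hx)
    simpa [Fin.sum_univ_succ, hu] using h
  have hleft : Tendsto (fun k => ∑ j : Fin m, dist (T w) (u (k + j + 1))) atTop
      (𝓝 (∑ _j : Fin m, dist (T w) w)) :=
    tendsto_finsetSum _ fun j _ => tendsto_const_nhds.dist (hshift (j + 1))
  have hright : Tendsto
      (fun k => lam * (dist w (T w) + ∑ j : Fin m, dist (u (k + j)) (u (k + j + 1)))) atTop
      (𝓝 (lam * (dist w (T w) + ∑ _j : Fin m, dist w w))) := by
    refine Tendsto.const_mul lam (Tendsto.add tendsto_const_nhds ?_)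
    exact tendsto_finsetSum _ fun j _ => (hshift j).dist (hshift (j + 1))
  have hlim := le_of_tendsto_of_tendsto hleft hright hineq
  simp only [dist_self, Finset.sum_const_zero, add_zero, Finset.sum_const, Finset.card_univ,
    Fintype.card_fin, nsmul_eq_mul, dist_comm w] at hlim
  by_contra hfix
  have hpos : 0 < dist (T w) w := dist_pos.2 hfix
  have hmR : (1 : ℝ) ≤ m := by exact_mod_cast hm
  nlinarith

/-- An `n`-point Kannan-type mapping on a complete metric space with no periodic
points of prime periods `2, 3, …, n−1` has a fixed point. -/
theorem statement6 {X : Type*} [MetricSpace X] [CompleteSpace X] (n : ℕ) (hn : 2 ≤ n)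
    (hcard : ∃ f : Fin n → X, Function.Injective f)
    (T : X → X)
    (lam : ℝ) (hlam0 : 0 ≤ lam) (hlam1 : lam < ((n : ℝ) - 1) / n)
    (hK : ∀ x : Fin n → X, Function.Injective x →
      pairSum (fun i => T (x i)) ≤ lam * ∑ i : Fin n, dist (x i) (T (x i)))
    (hper : ∀ p : ℕ, 2 ≤ p → p ≤ n - 1 →
      ¬∃ x : X, T^[p] x = x ∧ ∀ k : ℕ, 1 ≤ k → k < p → T^[k] x ≠ x) :
    ∃ w : X, T w = w := by
  obtain ⟨m, rfl⟩ : ∃ m, n = m + 1 := ⟨n - 1, by omega⟩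
  have hm : 1 ≤ m := by omega
  have hmR : (1 : ℝ) ≤ m := by exact_mod_cast hm
  rw [lt_div_iff₀ (by positivity)] at hlam1
  push_cast at hlam1
  have hlam : lam < 1 := by nlinarith
  by_contra! hfix
  have hinj := iterate_injective_fin (iterate_ne_self_of_prime_periods hfix hper)
  obtain ⟨f, -⟩ := hcard
  set q := lam / (m * (1 - lam))
  have hq0 : 0 ≤ q := div_nonneg hlam0 (mul_nonneg (by linarith) (by linarith))
  have hq1 : q < 1 := by
    refine (div_lt_one (mul_pos (by linarith) (by linarith))).2 ?_
    linarith
  let u : ℕ → X := fun k => T^[k] (f 0)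
  have hu (k : ℕ) : u (k + 1) = T (u k) := Function.iterate_succ_apply' T k _
  have hstep (k : ℕ) : dist (u (k + 1)) (u (k + 2)) ≤ q * dist (u k) (u (k + 1)) := by
    rw [hu (k + 1), hu k]
    exact dist_map_le_of_kannan hm hlam0 hlam hK (hinj _)
  have hpos (k : ℕ) : 0 < dist (u k) (u (k + 1)) := by
    rw [hu]
    exact dist_pos.2 (hfix _).symm
  obtain ⟨huinj, w, hw⟩ := injective_and_tendsto_of_dist_contraction hq0 hq1 hpos hstep
    fun i j h => by rw [hu, hu, h]
  exact hfix w (map_eq_of_tendsto_of_kannan hm hlam hK hu huinj hw)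
end

section
/- Let (X,d) be a complete metric space with |X| ≥ n ≥ 2, let T : X → X be an n-point Kannan-type mapping, and suppose T has a fixed point w that is the limit of an iteration sequence x_i = Tx_{i−1} (i ∈ ℕ) started at some x₀ ∈ X, with w ≠ x_i for all i ≥ 0. Then w is the unique fixed point of T. -/
open Finset Filter Topology

/-- If an orbit converges to a point it never visits, its terms are pairwise distinct. -/
lemma injective_iterate_of_tendsto {X : Type*} [TopologicalSpace X] [T2Space X] {T : X → X}
    {x w : X} (hlim : Tendsto (fun m => T^[m] x) atTop (𝓝 w)) (hne : ∀ m : ℕ, w ≠ T^[m] x) :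
    Function.Injective (fun m => T^[m] x) := by
  refine .of_lt_imp_ne fun a b hab h => hne a ?_
  have hper : Function.IsPeriodicPt T (b - a) (T^[a] x) := by
    rw [Function.IsPeriodicPt, Function.IsFixedPt, ← Function.iterate_add_apply,
      Nat.sub_add_cancel hab.le]
    exact h.symm
  have hsub : Tendsto (fun k : ℕ => (b - a) * k + a) atTop atTop :=
    tendsto_atTop_mono (fun k => (Nat.le_mul_of_pos_left k (Nat.sub_pos_of_lt hab)).trans
      (Nat.le_add_right _ a)) tendsto_id
  refine tendsto_nhds_unique (hlim.comp hsub) (tendsto_const_nhds.congr fun k => ?_)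
  simp only [Function.comp_apply, Function.iterate_add_apply]
  exact (hper.mul_const k).eq.symm

lemma dist_le_pairSum {X : Type*} [MetricSpace X] {n : ℕ} (x : Fin n → X) {i j : Fin n}
    (hij : i < j) : dist (x i) (x j) ≤ pairSum x :=
  (single_le_sum (f := fun j => dist (x i) (x j)) (fun _ _ => dist_nonneg)
    (mem_Ioi.2 hij)).trans <|
    single_le_sum (f := fun i => ∑ j ∈ Ioi i, dist (x i) (x j))
      (fun _ _ => sum_nonneg fun _ _ => dist_nonneg) (mem_univ i)

/-- If an `n`-point Kannan-type mapping on a complete metric space has a fixed point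
`w` which is the limit of an iteration sequence `x_m = T^m x₀` with `w ≠ x_m` for all
`m`, then `w` is the unique fixed point of `T`. -/
theorem statement8 {X : Type*} [MetricSpace X] [CompleteSpace X] (n : ℕ) (hn : 2 ≤ n)
    (hcard : ∃ f : Fin n → X, Function.Injective f)
    (T : X → X)
    (lam : ℝ) (hlam0 : 0 ≤ lam) (hlam1 : lam < ((n : ℝ) - 1) / n)
    (hK : ∀ x : Fin n → X, Function.Injective x →
      pairSum (fun i => T (x i)) ≤ lam * ∑ i : Fin n, dist (x i) (T (x i)))
    (x₀ : X) (w : X) (hw : T w = w)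
    (hlim : Filter.Tendsto (fun m => T^[m] x₀) Filter.atTop (nhds w))
    (hne : ∀ m : ℕ, w ≠ T^[m] x₀) :
    ∀ z : X, T z = z → z = w := by
  intro z hz
  obtain ⟨k, rfl⟩ : ∃ k, n = k + 2 := ⟨n - 2, by omega⟩
  have hinj := injective_iterate_of_tendsto hlim hne
  have hz_ne (m : ℕ) : z ≠ T^[m] x₀ := fun h => by
    have : T^[m + 1] x₀ = T^[m] x₀ := by rw [Function.iterate_succ_apply', ← h, hz]
    exact absurd (hinj this) (by omega)
  let p (m : ℕ) : Fin (k + 2) → X := Fin.cons z fun i => T^[m + i] x₀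
  have hp (m : ℕ) : Function.Injective (p m) := by
    refine Fin.cons_injective_iff.2 ⟨?_, fun i j h => ?_⟩
    · rintro ⟨i, hi⟩
      exact hz_ne _ hi.symm
    · exact Fin.ext (Nat.add_left_cancel (hinj h))
  have hle (m : ℕ) : dist z (T^[m + 1] x₀) ≤
      lam * ∑ i : Fin (k + 1), dist (T^[m + i] x₀) (T^[m + i + 1] x₀) := by
    have h := (dist_le_pairSum (fun i => T (p m i))
      (Fin.succ_pos (0 : Fin (k + 1)))).trans (hK (p m) (hp m))
    rw [Fin.sum_univ_succ] at h
    simpa only [p, Fin.cons_zero, Fin.cons_succ, hz, dist_self, zero_add, Fin.val_zero, add_zero,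
      ← Function.iterate_succ_apply' T] using h
  have hshift (i : ℕ) : Tendsto (fun m => T^[m + i] x₀) atTop (𝓝 w) :=
    hlim.comp (tendsto_add_atTop_nat i)
  have hright : Tendsto (fun m => lam * ∑ i : Fin (k + 1),
      dist (T^[m + i] x₀) (T^[m + i + 1] x₀)) atTop (𝓝 0) := by
    have := (tendsto_finsetSum (univ : Finset (Fin (k + 1))) fun i _ =>
      (hshift i).dist (hshift (i + 1))).const_mul lam
    simpa only [dist_self, sum_const_zero, mul_zero, ← add_assoc] using this
  exact dist_le_zero.1
    (le_of_tendsto_of_tendsto' (tendsto_const_nhds.dist (hshift 1)) hright hle)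
end

section
/- Let n ≥ 2 be an integer, let X = [0,2] with the Euclidean metric, and define T : X → X by T(x) = x/(n+2) if x is rational and T(x) = 0 if x is irrational. Then d(Tx,Ty) ≤ (1/(n+1))·(d(x,Tx) + d(y,Ty)) for all x,y ∈ X. -/
open Filter Topology

/-- The mapping `T : [0,2] → [0,2]` given by `T x = x/(n+2)` for rational `x` and
`T x = 0` for irrational `x`. -/
noncomputable def TEx (n : ℕ) (x : Set.Icc (0 : ℝ) 2) : Set.Icc (0 : ℝ) 2 :=
  open scoped Classical in
  if Irrational (x : ℝ) then ⟨0, by norm_num⟩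
  else ⟨(x : ℝ) / ((n : ℝ) + 2),
    ⟨div_nonneg x.2.1 (by positivity),
      by
        have h2 : (x : ℝ) ≤ 2 := x.2.2
        have h0 : (0 : ℝ) ≤ (x : ℝ) := x.2.1
        have hpos : (1 : ℝ) ≤ (n : ℝ) + 2 := by
          have := Nat.cast_nonneg (α := ℝ) n
          linarith
        have : (x : ℝ) / ((n : ℝ) + 2) ≤ (x : ℝ) := by
          apply div_le_self h0 hpos
        linarith⟩⟩

theorem TEx_le_dist (n : ℕ) (x : Set.Icc (0 : ℝ) 2) :
    (TEx n x : ℝ) ≤ 1 / ((n : ℝ) + 1) * dist x (TEx n x) := by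
  by_cases hx : Irrational (x : ℝ)
  · have hT : (TEx n x : ℝ) = 0 := by simp [TEx, hx]
    rw [hT]
    positivity
  · have hT : (TEx n x : ℝ) = (x : ℝ) / ((n : ℝ) + 2) := by simp [TEx, hx]
    have hd : (x : ℝ) - TEx n x ≤ dist x (TEx n x) := le_abs_self _
    calc (TEx n x : ℝ) = 1 / ((n : ℝ) + 1) * ((x : ℝ) - TEx n x) := by
          rw [hT]
          field_simp
          ring
      _ ≤ 1 / ((n : ℝ) + 1) * dist x (TEx n x) := by gcongr

/-- The mapping `TEx n` on `[0,2]` satisfies the Kannan condition with constant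
`1/(n+1)`. -/
theorem statement12 (n : ℕ) (hn : 2 ≤ n) :
    ∀ x y : Set.Icc (0 : ℝ) 2,
      dist (TEx n x) (TEx n y) ≤
        (1 / ((n : ℝ) + 1)) * (dist x (TEx n x) + dist y (TEx n y)) := by
  intro x y
  have hx := TEx_le_dist n x
  have hy := TEx_le_dist n y
  have hx0 : (0 : ℝ) ≤ TEx n x := (TEx n x).2.1
  have hy0 : (0 : ℝ) ≤ TEx n y := (TEx n y).2.1
  rw [Subtype.dist_eq (TEx n x), Real.dist_eq, mul_add]
  exact abs_sub_le_iff.mpr ⟨by linarith, by linarith⟩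
end

section
/- Let (X,d) be a complete metric space with |X| ≥ n ≥ 2, and let T : X → X be asymptotically regular (not assumed continuous). Suppose there exists λ ∈ [0,1) such that S(Tx₁,…,Txₙ) ≤ λ·Σᵢ₌₁ⁿ d(xᵢ,Txᵢ) for all pairwise distinct points x₁,…,xₙ ∈ X. Then T has a fixed point in X, and T has at most n−1 fixed points. -/
open Finset Filter Topology

/-- Orbits of an asymptotically regular map without fixed points never repeat a point. -/
lemma injective_iterate_of_asymptotically_regular {X : Type*} [MetricSpace X] {T : X → X} {x : X}
    (har : Tendsto (fun m => dist (T^[m] x) (T^[m + 1] x)) atTop (𝓝 0))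
    (hT : ∀ w, T w ≠ w) : Function.Injective fun m => T^[m] x := by
  refine Function.Injective.of_lt_imp_ne fun a b hab h => ?_
  obtain ⟨c, rfl⟩ := Nat.exists_eq_add_of_lt hab
  have hper : ∀ k, T^[a + k * (c + 1)] x = T^[a] x := by
    intro k
    induction k with
    | zero => simp
    | succ k ih =>
      have e : a + (k + 1) * (c + 1) = (c + 1) + (a + k * (c + 1)) := by ring
      rw [e, Function.iterate_add_apply, ih, ← Function.iterate_add_apply, add_comm, ← add_assoc]
      exact h.symm
  have hsub : Tendsto (fun k : ℕ => a + k * (c + 1)) atTop atTop :=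
    tendsto_atTop_mono (fun k => show k ≤ _ by nlinarith [Nat.zero_le (k * c)]) tendsto_id
  have hconst := har.comp hsub
  simp only [Function.comp_def, Function.iterate_succ_apply', hper] at hconst
  have hzero := tendsto_nhds_unique hconst tendsto_const_nhds
  exact hT _ (dist_eq_zero.1 hzero.symm).symm

/-- Applying the contraction condition to a point `a` and a block of `k + 1` consecutive points
of an orbit that avoids `a`. -/
lemma dist_orbit_le {X : Type*} [MetricSpace X] {k : ℕ} {T : X → X} {lam : ℝ}
    (hK : ∀ x : Fin (k + 2) → X, Function.Injective x →
      pairSum (fun i => T (x i)) ≤ lam * ∑ i, dist (x i) (T (x i)))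
    {u : ℕ → X} (hu : Function.Injective u) (huT : ∀ m, T (u m) = u (m + 1))
    {a : X} {q : ℕ} (ha : ∀ r, q ≤ r → u r ≠ a) :
    dist (T a) (u (q + 1)) ≤
      lam * (dist a (T a) + ∑ j : Fin (k + 1), dist (u (q + j)) (u (q + j + 1))) := by
  let x : Fin (k + 2) → X := Fin.cons a fun j : Fin (k + 1) => u (q + j)
  have hx : Function.Injective x := by
    refine Fin.cons_injective_iff.2 ⟨?_, fun i j hij => Fin.ext ?_⟩
    · rintro ⟨j, hj⟩
      exact ha _ (Nat.le_add_right _ _) hj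
    · exact Nat.add_left_cancel (hu hij)
  have hpair := dist_le_pairSum (fun i => T (x i)) (Fin.succ_pos (0 : Fin (k + 1)))
  have h := hpair.trans (hK x hx)
  rw [Fin.sum_univ_succ] at h
  simpa only [x, Fin.cons_zero, Fin.cons_succ, huT, Fin.val_zero, add_zero] using h

/-- An asymptotically regular (not necessarily continuous) `n`-point Kannan-type
mapping with coefficient `λ ∈ [0, 1)` on a complete metric space has a fixed point,
and has at most `n−1` fixed points. -/
theorem statement17 {X : Type*} [MetricSpace X] [CompleteSpace X] (n : ℕ) (hn : 2 ≤ n)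
    (hcard : ∃ f : Fin n → X, Function.Injective f)
    (T : X → X)
    (har : ∀ x : X,
      Filter.Tendsto (fun m => dist (T^[m] x) (T^[m + 1] x)) Filter.atTop (nhds 0))
    (lam : ℝ) (hlam0 : 0 ≤ lam) (hlam1 : lam < 1)
    (hK : ∀ x : Fin n → X, Function.Injective x →
      pairSum (fun i => T (x i)) ≤ lam * ∑ i : Fin n, dist (x i) (T (x i))) :
    (∃ w : X, T w = w) ∧
    ¬∃ w : Fin n → X, Function.Injective w ∧ ∀ i, T (w i) = w i := by
  constructor
  · obtain ⟨k, rfl⟩ := Nat.exists_eq_add_of_le' hn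
    by_contra! hT
    obtain ⟨f, -⟩ := hcard
    set u : ℕ → X := fun m => T^[m] (f 0)
    have huinj : Function.Injective u := injective_iterate_of_asymptotically_regular (har _) hT
    have huT : ∀ m, T (u m) = u (m + 1) := fun m => (Function.iterate_succ_apply' T m _).symm
    have hd : Tendsto (fun m => dist (u m) (u (m + 1))) atTop (𝓝 0) := har _
    set e : ℕ → ℝ := fun q => ∑ j : Fin (k + 1), dist (u (q + j)) (u (q + j + 1))
    have he0 : ∀ q, 0 ≤ e q := fun q => Finset.sum_nonneg fun _ _ => dist_nonneg
    have he : Tendsto e atTop (𝓝 0) := by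
      have := tendsto_finsetSum (Finset.univ : Finset (Fin (k + 1)))
        fun j _ => hd.comp (tendsto_add_atTop_nat (j : ℕ))
      simpa using this
    have hcauchy : CauchySeq fun m => u (m + 1) := by
      refine Metric.cauchySeq_iff'.2 fun ε hε => ?_
      have hd' := hd.eventually_lt_const (half_pos hε)
      have he' := he.eventually_lt_const (half_pos hε)
      obtain ⟨N, hN⟩ := eventually_atTop.1 (hd'.and he')
      refine ⟨N, fun q hq => ?_⟩
      rcases hq.eq_or_lt with rfl | hlt
      · simpa using hε
      · have h := dist_orbit_le hK huinj huT (a := u N) (q := q)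
          fun r hr h => by have := huinj h; omega
        rw [huT] at h
        rw [dist_comm]
        have h1 : lam * (dist (u N) (u (N + 1)) + e q) ≤ 1 * (dist (u N) (u (N + 1)) + e q) :=
          mul_le_mul_of_nonneg_right hlam1.le (add_nonneg dist_nonneg (he0 q))
        have := (hN N le_rfl).1
        have := (hN q hq).2
        linarith
    obtain ⟨z, hz⟩ := cauchySeq_tendsto_of_complete hcauchy
    have havoid : ∃ Q, ∀ r, Q ≤ r → u r ≠ z := by
      by_cases h : ∃ s, u s = z
      · obtain ⟨s, rfl⟩ := h
        exact ⟨s + 1, fun r hr h => by have := huinj h; omega⟩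
      · exact ⟨0, fun r _ h' => h ⟨r, h'⟩⟩
    obtain ⟨Q, hQ⟩ := havoid
    have hle : dist (T z) z ≤ lam * (dist z (T z) + 0) := by
      refine le_of_tendsto_of_tendsto (tendsto_const_nhds.dist hz)
        ((tendsto_const_nhds.add he).const_mul lam) ?_
      filter_upwards [eventually_ge_atTop Q] with q hq
      exact dist_orbit_le hK huinj huT fun r hr => hQ r (hq.trans hr)
    have hpos : 0 < dist (T z) z := dist_pos.2 (hT z)
    rw [dist_comm z] at hle
    nlinarith
  · rintro ⟨w, hw, hfix⟩
    have hsum := hK w hw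
    simp only [hfix, dist_self, Finset.sum_const_zero, mul_zero] at hsum
    have hlt : (⟨0, by omega⟩ : Fin n) < ⟨1, by omega⟩ := by simp
    have hpos := dist_pos.2 (hw.ne hlt.ne)
    linarith [dist_le_pairSum w hlt]
end

section
/- Let (X,d) be a metric space with |X| ≥ n ≥ 2, let T : X → X satisfy S(Tx₁,…,Txₙ) ≤ λ·Σᵢ₌₁ⁿ d(xᵢ,Txᵢ) for some λ ∈ [0,(n−1)/n) and all pairwise distinct x₁,…,xₙ ∈ X, and let x₀ ∈ X with iterates x_m = Tᵐx₀. If for some m ≥ 0 the n+1 consecutive points x_m, x_{m+1}, …, x_{m+n} are such that every n consecutive ones among them are pairwise distinct, then d(x_{m+n−1}, x_{m+n}) ≤ ρ·max_{0 ≤ i ≤ n−2} d(x_{m+i}, x_{m+i+1}), where ρ = (n−1)λ/(n−1−λ) < 1. -/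
open Finset Filter Topology

/-- The pairwise distance sum of `k + 2` points is at least `k + 1` times the distance between
the last two of them. -/
theorem mul_dist_last_le_pairSum {X : Type*} [MetricSpace X] {k : ℕ} (y : Fin (k + 2) → X) :
    ((k : ℝ) + 1) * dist (y (Fin.last k).castSucc) (y (Fin.last (k + 1))) ≤ pairSum y := by
  have key (i : Fin (k + 1)) : dist (y (Fin.last k).castSucc) (y (Fin.last (k + 1))) ≤
      ∑ j ∈ Finset.Ioi i.castSucc, dist (y i.castSucc) (y j) := by
    rcases (Fin.le_last i).eq_or_lt with rfl | hi
    · exact Finset.single_le_sum (f := fun j => dist (y (Fin.last k).castSucc) (y j))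
        (fun _ _ => dist_nonneg) (Finset.mem_Ioi.mpr (Fin.castSucc_lt_last _))
    · have hsub : ({(Fin.last k).castSucc, Fin.last (k + 1)} : Finset (Fin (k + 2))) ⊆
          Finset.Ioi i.castSucc := by
        intro j hj
        rcases Finset.mem_insert.mp hj with rfl | hj
        · exact Finset.mem_Ioi.mpr (Fin.castSucc_lt_castSucc_iff.mpr hi)
        · rw [Finset.mem_singleton.mp hj]
          exact Finset.mem_Ioi.mpr (Fin.castSucc_lt_last _)
      calc dist (y (Fin.last k).castSucc) (y (Fin.last (k + 1)))
          ≤ dist (y i.castSucc) (y (Fin.last k).castSucc) +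
              dist (y i.castSucc) (y (Fin.last (k + 1))) := dist_triangle_left _ _ _
        _ = ∑ j ∈ {(Fin.last k).castSucc, Fin.last (k + 1)}, dist (y i.castSucc) (y j) :=
            by rw [Finset.sum_pair (Fin.castSucc_lt_last _).ne]
        _ ≤ _ := Finset.sum_le_sum_of_subset_of_nonneg hsub fun _ _ _ => dist_nonneg
  have hsum := Finset.card_nsmul_le_sum Finset.univ _ _ fun i _ => key i
  rw [Finset.card_univ, Fintype.card_fin, nsmul_eq_mul] at hsum
  push_cast at hsum
  rw [pairSum, Fin.sum_univ_castSucc]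
  exact hsum.trans (le_add_of_nonneg_right (Finset.sum_nonneg fun _ _ => dist_nonneg))

/-- For an `n`-point Kannan-type mapping `T` and iterates `x_m = T^m x₀`, if among the
`n+1` consecutive points `x_m, …, x_{m+n}` every `n` consecutive ones are pairwise
distinct, then `d(x_{m+n−1}, x_{m+n}) ≤ ρ · max_{0 ≤ i ≤ n−2} d(x_{m+i}, x_{m+i+1})`,
where `ρ = (n−1)λ/(n−1−λ) < 1`. -/
theorem statement18 {X : Type*} [MetricSpace X] (n : ℕ) (hn : 2 ≤ n)
    (hcard : ∃ f : Fin n → X, Function.Injective f)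
    (T : X → X)
    (lam : ℝ) (hlam0 : 0 ≤ lam) (hlam1 : lam < ((n : ℝ) - 1) / n)
    (hK : ∀ x : Fin n → X, Function.Injective x →
      pairSum (fun i => T (x i)) ≤ lam * ∑ i : Fin n, dist (x i) (T (x i)))
    (x₀ : X) (m : ℕ)
    (hdist1 : ∀ i j : ℕ, i < n → j < n → i ≠ j → T^[m + i] x₀ ≠ T^[m + j] x₀)
    (hdist2 : ∀ i j : ℕ, i < n → j < n → i ≠ j → T^[m + 1 + i] x₀ ≠ T^[m + 1 + j] x₀) :
    ((n : ℝ) - 1) * lam / ((n : ℝ) - 1 - lam) < 1 ∧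
    dist (T^[m + n - 1] x₀) (T^[m + n] x₀) ≤
      ((n : ℝ) - 1) * lam / ((n : ℝ) - 1 - lam) *
        (Finset.range (n - 1)).sup'
          (Finset.nonempty_range_iff.mpr (by omega))
          (fun i => dist (T^[m + i] x₀) (T^[m + i + 1] x₀)) := by
  obtain ⟨k, rfl⟩ := Nat.exists_eq_add_of_le' hn
  have hk : (0 : ℝ) ≤ k := k.cast_nonneg
  have hn1 : ((k + 2 : ℕ) : ℝ) - 1 = k + 1 := by push_cast; ring
  rw [hn1] at hlam1 ⊢
  rw [lt_div_iff₀ (by positivity)] at hlam1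
  push_cast at hlam1
  have hpos : 0 < (k : ℝ) + 1 - lam := by nlinarith
  refine ⟨by rw [div_lt_one hpos]; linarith, ?_⟩
  set M := (Finset.range (k + 2 - 1)).sup' (Finset.nonempty_range_iff.mpr (by omega))
    (fun i => dist (T^[m + i] x₀) (T^[m + i + 1] x₀))
  have hle (i : Fin (k + 1)) : dist (T^[m + i] x₀) (T^[m + i + 1] x₀) ≤ M :=
    Finset.le_sup' (fun i => dist (T^[m + i] x₀) (T^[m + i + 1] x₀))
      (Finset.mem_range.mpr i.isLt)
  have hinj : Function.Injective fun i : Fin (k + 2) => T^[m + i] x₀ := fun i j hij => by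
    by_contra hne
    exact hdist1 i j i.isLt j.isLt (Fin.val_ne_of_ne hne) hij
  have hkannan := (mul_dist_last_le_pairSum _).trans (hK _ hinj)
  simp only [← Function.iterate_succ_apply'] at hkannan
  rw [Fin.sum_univ_castSucc] at hkannan
  have hsum := Finset.sum_le_card_nsmul Finset.univ _ _ fun i _ => hle i
  rw [Finset.card_univ, Fintype.card_fin, nsmul_eq_mul] at hsum
  push_cast at hsum
  change (_ : ℝ) * dist (T^[m + k + 1] x₀) (T^[m + (k + 1) + 1] x₀) ≤
    lam * (∑ i : Fin (k + 1), dist (T^[m + i] x₀) (T^[m + i + 1] x₀) +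
      dist (T^[m + k + 1] x₀) (T^[m + (k + 1) + 1] x₀)) at hkannan
  change dist (T^[m + k + 1] x₀) (T^[m + (k + 1) + 1] x₀) ≤ _
  rw [div_mul_eq_mul_div, le_div_iff₀ hpos]
  linarith [mul_le_mul_of_nonneg_left hsum hlam0]
end
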